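/- (Priority preservation, velocity control.) Let G be an acyclic priority graph, v̄_i > 0 for each i, and f^G the unique control law satisfying the fixed-point definition. Then χ^free_G is positively invariant under the closed-loop flow: for every x ∈ χ^free_G and every t ≥ 0, φ(t, x, f^G) ∈ χ^free_G. -/

import Mathlib

open Set

noncomputable section

/-- Canonical basis vector `e i` of the coordination space `ℝ^n`. -/
def basisVec (n : ℕ) (i : Fin n) : Fin n → ℝ := Pi.single i 1

/-- Collision cylinder `χ^obs_{ij} = {x : (x i, x j) ∈ κ i j}`. -/
def cyl (n : ℕ) (κ : Fin n → Fin n → Set (ℝ × ℝ)) (i j : Fin n) : Set (Fin n → ℝ) :=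
  {x | (x i, x j) ∈ κ i j}

/-- Completed cylinder `χ^obs_{i≻j} = χ^obs_{ij} − ℝ₊ e_i + ℝ₊ e_j` (Minkowski sums). -/
def cylPr (n : ℕ) (κ : Fin n → Fin n → Set (ℝ × ℝ)) (i j : Fin n) : Set (Fin n → ℝ) :=
  {z | ∃ y ∈ cyl n κ i j, ∃ a b : ℝ, 0 ≤ a ∧ 0 ≤ b ∧
    z = y - a • basisVec n i + b • basisVec n j}

/-- Obstacle region `χ^obs = ⋃_{i,j} χ^obs_{ij}`. -/
def obsRegion (n : ℕ) (κ : Fin n → Fin n → Set (ℝ × ℝ)) : Set (Fin n → ℝ) :=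
  ⋃ i, ⋃ j, cyl n κ i j

/-- Obstacle-free region `χ^free = χ \ χ^obs`. -/
def freeRegion (n : ℕ) (κ : Fin n → Fin n → Set (ℝ × ℝ)) : Set (Fin n → ℝ) :=
  (obsRegion n κ)ᶜ

/-- Standing hypotheses on the collision data `κ`: each `κ i j` is open, bounded and
convex, `κ i i = ∅`, and `(a,b) ∈ κ i j ↔ (b,a) ∈ κ j i`. -/
def KappaHyp (n : ℕ) (κ : Fin n → Fin n → Set (ℝ × ℝ)) : Prop :=
  (∀ i j, IsOpen (κ i j)) ∧ (∀ i j, Bornology.IsBounded (κ i j)) ∧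
  (∀ i j, Convex ℝ (κ i j)) ∧ (∀ i, κ i i = ∅) ∧
  (∀ (i j : Fin n) (a b : ℝ), (a, b) ∈ κ i j ↔ (b, a) ∈ κ j i)

/-- `PhiMem n C φ` : `φ` restricted to `[0,1]` is a continuous nondecreasing path whose
image lies in `C`, with `φ 0 − ℝ₊^n ⊆ C` and `φ 1 + ℝ₊^n ⊆ C` (the set `Φ(C)`). -/
def PhiMem (n : ℕ) (C : Set (Fin n → ℝ)) (φ : ℝ → Fin n → ℝ) : Prop :=
  ContinuousOn φ (Icc 0 1) ∧
  (∀ t1 ∈ Icc (0:ℝ) 1, ∀ t2 ∈ Icc (0:ℝ) 1, t1 ≤ t2 → φ t1 ≤ φ t2) ∧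
  (∀ t ∈ Icc (0:ℝ) 1, φ t ∈ C) ∧
  (∀ d : Fin n → ℝ, 0 ≤ d → φ 0 - d ∈ C) ∧
  (∀ d : Fin n → ℝ, 0 ≤ d → φ 1 + d ∈ C)

/-- A priority graph: `E i j ↔ (χ^obs_{ij} ≠ ∅ ∧ ¬ E j i)`. -/
def IsPriorityGraph (n : ℕ) (κ : Fin n → Fin n → Set (ℝ × ℝ))
    (E : Fin n → Fin n → Prop) : Prop :=
  ∀ i j, E i j ↔ (cyl n κ i j ≠ ∅ ∧ ¬ E j i)

/-- Completed obstacle region `χ^obs_G = ⋃_{(i,j) ∈ E(G)} χ^obs_{i≻j}`. -/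
def obsG (n : ℕ) (κ : Fin n → Fin n → Set (ℝ × ℝ))
    (E : Fin n → Fin n → Prop) : Set (Fin n → ℝ) :=
  ⋃ i, ⋃ j, ⋃ (_ : E i j), cylPr n κ i j

/-- `χ^free_G = χ \ χ^obs_G`. -/
def freeG (n : ℕ) (κ : Fin n → Fin n → Set (ℝ × ℝ))
    (E : Fin n → Fin n → Prop) : Set (Fin n → ℝ) :=
  (obsG n κ E)ᶜ

/-- `E` contains a directed cycle. -/
def HasCycle (n : ℕ) (E : Fin n → Fin n → Prop) : Prop :=
  ∃ (m : ℕ) (v : ℕ → Fin n), 0 < m ∧ v m = v 0 ∧ ∀ k < m, E (v k) (v (k+1))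

/-- The braking condition of the control law: moving robot `i` at maximal speed for one
time slot while a higher-priority robot `j` (an edge `(j,i)` of `G`) moves at speed
`f x j` would violate the priority `j ≻ i`. -/
def CtrlCond (n : ℕ) (κ : Fin n → Fin n → Set (ℝ × ℝ)) (E : Fin n → Fin n → Prop)
    (vbar : Fin n → ℝ) (f : (Fin n → ℝ) → Fin n → ℝ) (x : Fin n → ℝ) (i : Fin n) :
    Prop :=
  ∃ j, E j i ∧ ∃ t ∈ Icc (0:ℝ) 1,
    x + t • (vbar i • basisVec n i + f x j • basisVec n j) ∈ cylPr n κ j i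

/-- `f` satisfies the fixed-point definition of the priority preserving control law
`f^G` for velocity-controlled robots: `f x i ∈ {0, v̄ i}`, `f x i = 0` when the
braking condition holds, and `f x i = v̄ i` otherwise. -/
def CtrlLawSpec (n : ℕ) (κ : Fin n → Fin n → Set (ℝ × ℝ)) (E : Fin n → Fin n → Prop)
    (vbar : Fin n → ℝ) (f : (Fin n → ℝ) → Fin n → ℝ) : Prop :=
  (∀ x i, f x i = 0 ∨ f x i = vbar i) ∧
  (∀ x i, (CtrlCond n κ E vbar f x i → f x i = 0) ∧
          (¬ CtrlCond n κ E vbar f x i → f x i = vbar i))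

/-- Flow of a (slotwise constant) velocity control `v : ℕ → ℝ^n` from `x`:
`φ(k + τ) = φ(k) + τ • v k` for `k ∈ ℕ` and `τ ∈ [0,1]`. -/
def flowVel (n : ℕ) (x : Fin n → ℝ) (v : ℕ → Fin n → ℝ) (t : ℝ) : Fin n → ℝ :=
  x + (∑ k ∈ Finset.range ⌊t⌋₊, v k) + (t - (⌊t⌋₊ : ℝ)) • v ⌊t⌋₊

/-- Positions at integer times of the closed-loop system under feedback law `f`. -/
def clSeq (n : ℕ) (f : (Fin n → ℝ) → Fin n → ℝ) (x : Fin n → ℝ) : ℕ → Fin n → ℝ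
  | 0 => x
  | k + 1 => clSeq n f x k + f (clSeq n f x k)

/-- Closed-loop flow `φ(·, x, f)`: the flow of the velocity control defined recursively
by `v k = f (φ(k, x, f))`. -/
def clFlow (n : ℕ) (f : (Fin n → ℝ) → Fin n → ℝ) (x : Fin n → ℝ) (t : ℝ) :
    Fin n → ℝ :=
  flowVel n x (fun k => f (clSeq n f x k)) t

lemma IsPriorityGraph.ne_of_edge {n : ℕ} {κ : Fin n → Fin n → Set (ℝ × ℝ)}
    {E : Fin n → Fin n → Prop} (hE : IsPriorityGraph n κ E) {i j : Fin n} (h : E i j) :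
    i ≠ j := by
  rintro rfl
  exact ((hE i i).1 h).2 h

/-- For distinct robots, a completed cylinder is described by two coordinates only. -/
lemma mem_cylPr_iff {n : ℕ} {κ : Fin n → Fin n → Set (ℝ × ℝ)} {i j : Fin n} (hij : i ≠ j)
    (z : Fin n → ℝ) :
    z ∈ cylPr n κ i j ↔ ∃ p q : ℝ, (p, q) ∈ κ i j ∧ z i ≤ p ∧ q ≤ z j := by
  constructor
  · rintro ⟨y, hy, a, b, ha, hb, rfl⟩
    exact ⟨y i, y j, hy, by simp [basisVec, hij, ha], by simp [basisVec, hij.symm, hb]⟩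
  · rintro ⟨p, q, hpq, hp, hq⟩
    refine ⟨z + (p - z i) • basisVec n i - (z j - q) • basisVec n j, ?_, p - z i, z j - q,
      sub_nonneg.2 hp, sub_nonneg.2 hq, by abel⟩
    simpa [cyl, basisVec, hij, hij.symm] using hpq

lemma CtrlLawSpec.nonneg {n : ℕ} {κ : Fin n → Fin n → Set (ℝ × ℝ)} {E : Fin n → Fin n → Prop}
    {vbar : Fin n → ℝ} {f : (Fin n → ℝ) → Fin n → ℝ} (hf : CtrlLawSpec n κ E vbar f)
    (hv : ∀ i, 0 < vbar i) (x : Fin n → ℝ) (i : Fin n) : 0 ≤ f x i := by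
  rcases hf.1 x i with h | h
  · exact h.ge
  · exact h ▸ (hv i).le

/-- The free region is invariant during one time slot. -/
lemma CtrlLawSpec.add_smul_mem_freeG {n : ℕ} {κ : Fin n → Fin n → Set (ℝ × ℝ)}
    {E : Fin n → Fin n → Prop} (hE : IsPriorityGraph n κ E) {vbar : Fin n → ℝ}
    (hv : ∀ i, 0 < vbar i) {f : (Fin n → ℝ) → Fin n → ℝ} (hf : CtrlLawSpec n κ E vbar f)
    {x : Fin n → ℝ} (hx : x ∈ freeG n κ E) {t : ℝ} (ht : t ∈ Icc (0 : ℝ) 1) :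
    x + t • f x ∈ freeG n κ E := by
  intro hmem
  simp only [obsG, mem_iUnion] at hmem
  obtain ⟨j, i, hji, hmem⟩ := hmem
  have hne := hE.ne_of_edge hji
  obtain ⟨p, q, hpq, hp, hq⟩ := (mem_cylPr_iff hne _).1 hmem
  simp only [Pi.add_apply, Pi.smul_apply, smul_eq_mul] at hp hq
  by_cases hc : CtrlCond n κ E vbar f x i
  · rw [(hf.2 x i).1 hc] at hq
    refine hx ?_
    simp only [obsG, mem_iUnion]
    refine ⟨j, i, hji, (mem_cylPr_iff hne _).2 ⟨p, q, hpq, ?_, by simpa using hq⟩⟩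
    linarith [mul_nonneg ht.1 (hf.nonneg hv x j)]
  · rw [(hf.2 x i).2 hc] at hq
    refine hc ⟨j, hji, t, ht, (mem_cylPr_iff hne _).2 ⟨p, q, hpq, ?_, ?_⟩⟩
    · simpa [basisVec, hne] using hp
    · simpa [basisVec, hne.symm] using hq

lemma clSeq_eq_add_sum {n : ℕ} (f : (Fin n → ℝ) → Fin n → ℝ) (x : Fin n → ℝ) (k : ℕ) :
    clSeq n f x k = x + ∑ l ∈ Finset.range k, f (clSeq n f x l) := by
  induction k with
  | zero => simp [clSeq]
  | succ k ih => rw [Finset.sum_range_succ, ← add_assoc, ← ih, clSeq]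

/-- priority preservation, velocity control: `χ^free_G` is positively
invariant under the closed-loop flow of the control law `f^G`. -/
theorem stmt16 (n : ℕ) (hn : 1 ≤ n) (κ : Fin n → Fin n → Set (ℝ × ℝ))
    (hκ : KappaHyp n κ) (E : Fin n → Fin n → Prop) (hE : IsPriorityGraph n κ E)
    (hacyc : ¬ HasCycle n E) (vbar : Fin n → ℝ) (hv : ∀ i, 0 < vbar i)
    (f : (Fin n → ℝ) → Fin n → ℝ) (hf : CtrlLawSpec n κ E vbar f) :
    ∀ x ∈ freeG n κ E, ∀ t : ℝ, 0 ≤ t → clFlow n f x t ∈ freeG n κ E := by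
  intro x hx t ht
  have hseq : ∀ k, clSeq n f x k ∈ freeG n κ E := by
    intro k
    induction k with
    | zero => exact hx
    | succ k ih =>
      simpa [clSeq] using hf.add_smul_mem_freeG hE hv ih (t := 1) (by simp)
  have hfrac : t - (⌊t⌋₊ : ℝ) ∈ Icc (0 : ℝ) 1 :=
    ⟨sub_nonneg.2 (Nat.floor_le ht), by linarith [Nat.lt_floor_add_one t]⟩
  have hmem := hf.add_smul_mem_freeG hE hv (hseq ⌊t⌋₊) hfrac
  rw [clFlow, flowVel, ← clSeq_eq_add_sum]
  exact hmem
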